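/- arXiv:2205.13653 — 2 statements merged into one kernel-verified Lean document; each statement's English description precedes it below -/
import Mathlib

section
/- Let (X_1,...,X_k) be a primal optimal solution of (SDP-P) and (Y, Z_1,...,Z_k, ν) a dual optimal solution of (SDP-D). If rank(Z_i) = d−1 for every i = 1,...,k, then rank(X_i) = 1 for every i; moreover each X_i = u_i u_iᵀ for a unit vector u_i, and the vectors u_1,...,u_k are pairwise orthogonal. -/
open Matrix

/-- Objective of the primal SDP (SDP-P): `∑ i, tr (M i * X i)`. -/
noncomputable def primalObj {d k : ℕ} (M X : Fin k → Matrix (Fin d) (Fin d) ℝ) : ℝ :=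
  ∑ i, (M i * X i).trace

/-- Feasibility for the primal SDP (SDP-P). -/
def PrimalFeasible {d k : ℕ} (X : Fin k → Matrix (Fin d) (Fin d) ℝ) : Prop :=
  (∀ i, (X i).PosSemidef) ∧ (∀ i, (X i).trace = 1) ∧
    ((1 : Matrix (Fin d) (Fin d) ℝ) - ∑ i, X i).PosSemidef

/-- Objective of the dual SDP (SDP-D): `tr Y + ∑ i, ν i`. -/
noncomputable def dualObj {d k : ℕ} (Y : Matrix (Fin d) (Fin d) ℝ) (ν : Fin k → ℝ) : ℝ :=
  Y.trace + ∑ i, ν i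

/-- Feasibility for the dual SDP (SDP-D). -/
def DualFeasible {d k : ℕ} (M : Fin k → Matrix (Fin d) (Fin d) ℝ)
    (Y : Matrix (Fin d) (Fin d) ℝ) (Z : Fin k → Matrix (Fin d) (Fin d) ℝ)
    (ν : Fin k → ℝ) : Prop :=
  Y.PosSemidef ∧ (∀ i, (Z i).PosSemidef) ∧
    (∀ i, Y = M i + Z i - ν i • (1 : Matrix (Fin d) (Fin d) ℝ))

namespace Matrix

variable {n : Type*} [Fintype n]

lemma trace_mul_vecMulVec (u v : n → ℝ) (A : Matrix n n ℝ) :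
    (A * vecMulVec u v).trace = v ⬝ᵥ A *ᵥ u := by
  rw [mul_vecMulVec, trace_vecMulVec, dotProduct_comm]

lemma PosSemidef.dotProduct_mulVec_self_nonneg {A : Matrix n n ℝ} (hA : A.PosSemidef)
    (x : n → ℝ) : 0 ≤ x ⬝ᵥ A *ᵥ x := by
  simpa using hA.dotProduct_mulVec_nonneg x

lemma PosSemidef.mulVec_eq_zero {A : Matrix n n ℝ} (hA : A.PosSemidef) {x : n → ℝ}
    (hx : x ⬝ᵥ A *ᵥ x = 0) : A *ᵥ x = 0 :=
  (hA.dotProduct_mulVec_zero_iff x).1 (by simpa using hx)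

lemma PosSemidef.trace_mul_nonneg {A B : Matrix n n ℝ} (hA : A.PosSemidef)
    (hB : B.PosSemidef) : 0 ≤ (A * B).trace := by
  obtain ⟨m, v, rfl⟩ := posSemidef_iff_eq_sum_vecMulVec.1 hB
  simp only [Matrix.mul_sum, trace_sum, star_trivial, trace_mul_vecMulVec]
  exact Finset.sum_nonneg fun i _ => hA.dotProduct_mulVec_self_nonneg _

/-- Complementary slackness for positive semidefinite matrices. -/
lemma PosSemidef.mul_eq_zero_of_trace_mul_eq_zero {A B : Matrix n n ℝ} (hA : A.PosSemidef)
    (hB : B.PosSemidef) (h : (A * B).trace = 0) : A * B = 0 := by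
  obtain ⟨m, v, rfl⟩ := posSemidef_iff_eq_sum_vecMulVec.1 hB
  simp only [Matrix.mul_sum, trace_sum, star_trivial, trace_mul_vecMulVec] at h ⊢
  rw [Finset.sum_eq_zero_iff_of_nonneg
    fun i _ => hA.dotProduct_mulVec_self_nonneg _] at h
  refine Finset.sum_eq_zero fun i hi => ?_
  rw [mul_vecMulVec, hA.mulVec_eq_zero (h i hi), zero_vecMulVec]

/-- A positive semidefinite matrix stays so under a small perturbation which is positive definite
on its kernel. -/
lemma PosSemidef.eventually_add_smul {A H : Matrix n n ℝ} (hA : A.PosSemidef)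
    (hH : H.IsHermitian) (hpos : ∀ x, x ≠ 0 → A *ᵥ x = 0 → 0 < x ⬝ᵥ H *ᵥ x) :
    ∀ᶠ t in nhdsWithin (0 : ℝ) (Set.Ioi 0), (A + t • H).PosSemidef := by
  obtain ⟨t₀, ht₀, h⟩ : ∃ t₀ : ℝ, 0 < t₀ ∧
      ∀ x ∈ Metric.sphere (0 : n → ℝ) 1, 0 ≤ x ⬝ᵥ A *ᵥ x + t₀ * (x ⬝ᵥ H *ᵥ x) := by
    have hcA : Continuous fun x : n → ℝ => x ⬝ᵥ A *ᵥ x := by fun_prop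
    have hcH : Continuous fun x : n → ℝ => x ⬝ᵥ H *ᵥ x := by fun_prop
    let K : Set (n → ℝ) := Metric.sphere 0 1 ∩ {x | x ⬝ᵥ H *ᵥ x ≤ 0}
    have hK : IsCompact K :=
      (isCompact_sphere _ _).inter_right (isClosed_le hcH continuous_const)
    have hKpos : ∀ x ∈ K, 0 < x ⬝ᵥ A *ᵥ x := fun x hx => by
      refine lt_of_le_of_ne (hA.dotProduct_mulVec_self_nonneg x) fun h0 => ?_
      refine absurd (hpos x ?_ (hA.mulVec_eq_zero h0.symm)) (not_lt.2 hx.2)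
      rintro rfl
      simpa using hx.1
    obtain hE | hE := K.eq_empty_or_nonempty
    · refine ⟨1, one_pos, fun x hx => ?_⟩
      have : ¬ x ⬝ᵥ H *ᵥ x ≤ 0 := fun hx' => hE.subset ⟨hx, hx'⟩
      have := hA.dotProduct_mulVec_self_nonneg x
      linarith
    · obtain ⟨a, ha, hmin⟩ := hK.exists_isMinOn hE hcA.continuousOn
      obtain ⟨b, hb, hmin'⟩ := hK.exists_isMinOn hE hcH.continuousOn
      have ha' := hKpos a ha
      have hb' : b ⬝ᵥ H *ᵥ b ≤ 0 := hb.2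
      have hden : 0 < 1 - b ⬝ᵥ H *ᵥ b := by linarith
      refine ⟨(a ⬝ᵥ A *ᵥ a) / (1 - b ⬝ᵥ H *ᵥ b), div_pos ha' hden, fun x hx => ?_⟩
      have hs := div_pos ha' hden
      by_cases hx' : x ⬝ᵥ H *ᵥ x ≤ 0
      · have h1 : a ⬝ᵥ A *ᵥ a ≤ x ⬝ᵥ A *ᵥ x := hmin ⟨hx, hx'⟩
        have h2 : b ⬝ᵥ H *ᵥ b ≤ x ⬝ᵥ H *ᵥ x := hmin' ⟨hx, hx'⟩
        have h3 := div_mul_cancel₀ (a ⬝ᵥ A *ᵥ a) hden.ne'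
        nlinarith
      · have := hA.dotProduct_mulVec_self_nonneg x
        have := mul_pos hs (not_le.1 hx')
        linarith
  filter_upwards [Ioc_mem_nhdsGT ht₀] with t ht
  refine .of_dotProduct_mulVec_nonneg (hA.1.add (by simpa [IsHermitian] using congrArg (t • ·) hH))
    fun x => ?_
  simp only [star_trivial, add_mulVec, smul_mulVec, dotProduct_add, dotProduct_smul, smul_eq_mul]
  have hx := hA.dotProduct_mulVec_self_nonneg x
  have h0 : 0 ≤ x ⬝ᵥ A *ᵥ x + t₀ * (x ⬝ᵥ H *ᵥ x) := by
    by_cases hx0 : x = 0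
    · simp [hx0]
    have hn : 0 < ‖x‖ := norm_pos_iff.2 hx0
    have := h (‖x‖⁻¹ • x) (by simp [norm_smul, hn.ne'])
    simp only [mulVec_smul, dotProduct_smul, smul_dotProduct, smul_eq_mul] at this
    have e := mul_nonneg (mul_nonneg hn.le hn.le) this
    field_simp at e
    linarith
  by_cases hs : 0 ≤ x ⬝ᵥ H *ᵥ x
  · have := mul_nonneg ht.1.le hs
    linarith
  · nlinarith [ht.2]

lemma exists_unit_vector_span_ker {A : Matrix n n ℝ} [Nonempty n]
    (hA : A.rank = Fintype.card n - 1) :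
    ∃ u : n → ℝ, u ⬝ᵥ u = 1 ∧ A *ᵥ u = 0 ∧ ∀ x, A *ᵥ x = 0 → ∃ c : ℝ, x = c • u := by
  have hker : Module.finrank ℝ (LinearMap.ker A.mulVecLin) = 1 := by
    have := A.mulVecLin.finrank_range_add_finrank_ker
    have hp := Fintype.card_pos (α := n)
    rw [Module.finrank_fintype_fun_eq_card] at this
    rw [rank] at hA
    omega
  obtain ⟨⟨v, hv⟩, hv0, hspan⟩ := finrank_eq_one_iff'.1 hker
  have hv0' : v ≠ 0 := fun h => hv0 (by simpa using h)
  have hvpos : 0 < v ⬝ᵥ v := by simpa using dotProduct_self_star_pos_iff.2 hv0'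
  have hs := Real.sqrt_pos.2 hvpos
  have hs2 := Real.mul_self_sqrt hvpos.le
  refine ⟨(√(v ⬝ᵥ v))⁻¹ • v, ?_, ?_, fun x hx => ?_⟩
  · simp only [smul_dotProduct, dotProduct_smul, smul_eq_mul]
    field_simp
    nlinarith
  · rw [mulVec_smul, show A *ᵥ v = 0 from hv, smul_zero]
  · obtain ⟨c, hc⟩ := hspan ⟨x, hx⟩
    refine ⟨c * √(v ⬝ᵥ v), ?_⟩
    rw [smul_smul, mul_assoc, mul_inv_cancel₀ hs.ne', mul_one]
    exact (congrArg Subtype.val hc).symm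

/-- A symmetric matrix of trace one whose range lies in a line is the projection onto that line. -/
lemma IsHermitian.eq_vecMulVec_self [DecidableEq n] {B : Matrix n n ℝ}
    (hB : B.IsHermitian) (htr : B.trace = 1) {u : n → ℝ} (hu : u ⬝ᵥ u = 1) (h : ∀ x, ∃ c : ℝ, B *ᵥ x = c • u) :
    B = vecMulVec u u := by
  choose c hc using h
  obtain ⟨w, hw⟩ : ∃ w : n → ℝ, B = vecMulVec u w := by
    refine ⟨fun j => c (Pi.single j 1), ?_⟩
    ext i j
    have := congrFun (hc (Pi.single j 1)) i
    simpa [mulVec_single_one, vecMulVec_apply, mul_comm] using this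
  have hw' : B = vecMulVec w u := by
    rw [← transpose_vecMulVec, ← hw]
    simpa using hB.symm
  have h1 : B *ᵥ u = (w ⬝ᵥ u) • u := by
    rw [hw, vecMulVec_mulVec]; simp
  have h2 : B *ᵥ u = w := by
    rw [hw', vecMulVec_mulVec, hu]; simp
  have h3 : w ⬝ᵥ u = 1 := by rw [← trace_vecMulVec, ← hw', htr]
  rw [h2, h3, one_smul] at h1
  rw [hw, h1]

end Matrix

variable {d k : ℕ}

/-- Directions which are feasible for `Y` cannot decrease the dual objective, when each `ν i` is
adjusted so as to keep `Z i` positive semidefinite. -/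
lemma DualFeasible.trace_sub_sum_nonneg {M : Fin k → Matrix (Fin d) (Fin d) ℝ}
    {Y : Matrix (Fin d) (Fin d) ℝ} {Z : Fin k → Matrix (Fin d) (Fin d) ℝ} {ν : Fin k → ℝ}
    (hfeas : DualFeasible M Y Z ν)
    (hopt : ∀ Y' Z' ν', DualFeasible M Y' Z' ν' → dualObj Y ν ≤ dualObj Y' ν')
    {u : Fin k → Fin d → ℝ} (hu : ∀ i, u i ⬝ᵥ u i = 1)
    (hker : ∀ i x, Z i *ᵥ x = 0 → ∃ c : ℝ, x = c • u i)
    {H : Matrix (Fin d) (Fin d) ℝ} (hH : H.IsHermitian)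
    (hY : ∀ᶠ t in nhdsWithin (0 : ℝ) (Set.Ioi 0), (Y + t • H).PosSemidef) :
    0 ≤ H.trace - ∑ i, u i ⬝ᵥ H *ᵥ u i := by
  have key : ∀ ε > 0, 0 ≤ H.trace - ∑ i, u i ⬝ᵥ H *ᵥ u i + k * ε := by
    intro ε hε
    let η : Fin k → ℝ := fun i => ε - u i ⬝ᵥ H *ᵥ u i
    have hZ : ∀ᶠ t in nhdsWithin (0 : ℝ) (Set.Ioi 0), ∀ i,
        (Z i + t • (H + η i • (1 : Matrix (Fin d) (Fin d) ℝ))).PosSemidef := by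
      refine Filter.eventually_all.2 fun i => (hfeas.2.1 i).eventually_add_smul ?_ ?_
      · exact hH.add (by simp [IsHermitian])
      · intro x hx hx0
        obtain ⟨c, rfl⟩ := hker i x hx0
        have hc : c ≠ 0 := by rintro rfl; simp at hx
        have : 0 < c * c * ε := mul_pos (mul_self_pos.2 hc) hε
        simp only [mulVec_smul, add_mulVec, smul_mulVec, one_mulVec, dotProduct_smul,
          smul_dotProduct, dotProduct_add, smul_eq_mul, hu, η]
        linarith
    obtain ⟨t, ⟨htY, htZ⟩, ht⟩ := ((hY.and hZ).and self_mem_nhdsWithin).exists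
    have ht : 0 < t := ht
    have := hopt (Y + t • H) (fun i => Z i + t • (H + η i • 1)) (fun i => ν i + t * η i)
      ⟨htY, htZ, fun i => by
        nth_rw 1 [hfeas.2.2 i]
        module⟩
    simp only [dualObj, trace_add, trace_smul, smul_eq_mul, Finset.sum_add_distrib,
      ← Finset.mul_sum, η, Finset.sum_sub_distrib, Finset.sum_const, Finset.card_univ,
      Fintype.card_fin, nsmul_eq_mul] at this
    have h2 : 0 ≤ t * (H.trace - ∑ i, u i ⬝ᵥ H *ᵥ u i + k * ε) := by linarith
    exact nonneg_of_mul_nonneg_right h2 ht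
  refine le_of_forall_pos_le_add fun δ hδ => ?_
  have hk : (0 : ℝ) < k + 1 := by positivity
  have h1 := key (δ / (k + 1)) (by positivity)
  have h2 : k * (δ / (k + 1)) ≤ δ := by
    rw [mul_div_assoc', div_le_iff₀ hk]
    nlinarith
  linarith

lemma DualFeasible.dualObj_sub_primalObj {M X : Fin k → Matrix (Fin d) (Fin d) ℝ}
    {Y : Matrix (Fin d) (Fin d) ℝ} {Z : Fin k → Matrix (Fin d) (Fin d) ℝ} {ν : Fin k → ℝ}
    (hfeas : DualFeasible M Y Z ν) (htr : ∀ i, (X i).trace = 1) :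
    dualObj Y ν - primalObj M X = (Y * (1 - ∑ i, X i)).trace + ∑ i, (Z i * X i).trace := by
  have hM : ∀ i, (M i * X i).trace = (Y * X i).trace - (Z i * X i).trace + ν i := fun i => by
    have : M i = Y - Z i + ν i • (1 : Matrix (Fin d) (Fin d) ℝ) := by
      rw [hfeas.2.2 i]; module
    rw [this]
    simp [add_mul, sub_mul, htr i]
  simp only [dualObj, primalObj, hM, mul_sub, mul_one, Matrix.mul_sum, trace_sub, trace_sum,
    Finset.sum_add_distrib, Finset.sum_sub_distrib]
  ring

/-- Unit vectors whose projections sum to at most the identity are pairwise orthogonal. -/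
lemma dotProduct_eq_zero_of_one_sub_sum_posSemidef {u : Fin k → Fin d → ℝ}
    (hu : ∀ i, u i ⬝ᵥ u i = 1)
    (h : ((1 : Matrix (Fin d) (Fin d) ℝ) - ∑ i, vecMulVec (u i) (u i)).PosSemidef)
    {i j : Fin k} (hij : i ≠ j) : u i ⬝ᵥ u j = 0 := by
  have h1 := h.dotProduct_mulVec_self_nonneg (u i)
  have h2 : ∑ l, (u i ⬝ᵥ u l) * (u i ⬝ᵥ u l) ≤ 1 := by
    simp only [sub_mulVec, one_mulVec, sum_mulVec, vecMulVec_mulVec, dotProduct_sub,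
      dotProduct_sum, hu] at h1
    simpa [dotProduct_comm _ (u i)] using h1
  have h3 := Finset.add_le_sum (f := fun l => (u i ⬝ᵥ u l) * (u i ⬝ᵥ u l))
    (fun l _ => mul_self_nonneg _) (Finset.mem_univ i) (Finset.mem_univ j) hij
  simp only [hu] at h3
  exact mul_self_eq_zero.1 (le_antisymm (by linarith) (mul_self_nonneg _))

/-- If all the optimal dual slack matrices `Z i` have rank `d − 1`, then the optimal primal
matrices `X i` are rank one; in fact `X i = uᵢ uᵢᵀ` for pairwise orthogonal unit vectors. -/
theorem rank_one_of_dual_rank {d k : ℕ} (hk : 1 ≤ k) (hkd : k ≤ d)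
    (M : Fin k → Matrix (Fin d) (Fin d) ℝ) (hM : ∀ i, (M i).IsHermitian)
    (X : Fin k → Matrix (Fin d) (Fin d) ℝ) (hXfeas : PrimalFeasible X)
    (hXopt : ∀ X', PrimalFeasible X' → primalObj M X' ≤ primalObj M X)
    (Y : Matrix (Fin d) (Fin d) ℝ) (Z : Fin k → Matrix (Fin d) (Fin d) ℝ) (ν : Fin k → ℝ)
    (hDfeas : DualFeasible M Y Z ν)
    (hDopt : ∀ Y' Z' ν', DualFeasible M Y' Z' ν' → dualObj Y ν ≤ dualObj Y' ν')
    (hZ : ∀ i, (Z i).rank = d - 1) :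
    (∀ i, (X i).rank = 1) ∧
    ∃ u : Fin k → (Fin d → ℝ),
      (∀ i, u i ⬝ᵥ u i = 1) ∧
      (∀ i j, i ≠ j → u i ⬝ᵥ u j = 0) ∧
      (∀ i, X i = vecMulVec (u i) (u i)) := by
  have : Nonempty (Fin d) := ⟨⟨0, by omega⟩⟩
  choose u hu hZu hker using fun i =>
    exists_unit_vector_span_ker (A := Z i) (by simpa using hZ i)
  have hdir := fun H hH => hDfeas.trace_sub_sum_nonneg hDopt hu hker (H := H) hH
  let U : Fin k → Matrix (Fin d) (Fin d) ℝ := fun i => vecMulVec (u i) (u i)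
  have hU : PrimalFeasible U := by
    refine ⟨fun i => by simpa using posSemidef_vecMulVec_self_star (u i), fun i => ?_, ?_⟩
    · rw [trace_vecMulVec, hu]
    · refine .of_dotProduct_mulVec_nonneg ?_ fun x => ?_
      · simp [IsHermitian, U, transpose_sum, transpose_vecMulVec]
      · have hx : (vecMulVec x x).PosSemidef := by
          simpa using posSemidef_vecMulVec_self_star x
        have := hdir _ hx.1 <| by
          filter_upwards [self_mem_nhdsWithin] with t ht
          exact hDfeas.1.add (hx.smul (le_of_lt ht))
        simpa [U, sub_mulVec, sum_mulVec, vecMulVec_mulVec, dotProduct_sum, dotProduct_comm _ x,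
          trace_vecMulVec] using this
  have hgapU : dualObj Y ν ≤ primalObj M U := by
    have hYU := hdir (-Y) hDfeas.1.1.neg <| by
      filter_upwards [Ioc_mem_nhdsGT one_pos] with t ht
      convert hDfeas.1.smul (sub_nonneg.2 ht.2) using 1
      module
    have := hDfeas.dualObj_sub_primalObj hU.2.1
    simp only [U, mul_sub, Matrix.mul_sum, trace_sub, trace_sum, trace_mul_vecMulVec, hZu,
      dotProduct_zero, Finset.sum_const_zero, mul_one] at this
    simp only [trace_neg, neg_mulVec, dotProduct_neg, Finset.sum_neg_distrib] at hYU
    linarith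
  have hgap := hDfeas.dualObj_sub_primalObj hXfeas.2.1
  have hZX0 : ∀ i, 0 ≤ (Z i * X i).trace :=
    fun i => (hDfeas.2.1 i).trace_mul_nonneg (hXfeas.1 i)
  have hsum : ∑ i, (Z i * X i).trace = 0 := by
    have h1 := hDfeas.1.trace_mul_nonneg hXfeas.2.2
    have h2 := hXopt U hU
    have h3 := Finset.sum_nonneg fun i (_ : i ∈ Finset.univ) => hZX0 i
    linarith
  have hX : ∀ i, X i = vecMulVec (u i) (u i) := fun i => by
    have hZX := (hDfeas.2.1 i).mul_eq_zero_of_trace_mul_eq_zero (hXfeas.1 i)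
      ((Finset.sum_eq_zero_iff_of_nonneg fun i _ => hZX0 i).1 hsum i (Finset.mem_univ i))
    refine (hXfeas.1 i).1.eq_vecMulVec_self (hXfeas.2.1 i) (hu i) fun x => hker i _ ?_
    rw [mulVec_mulVec, hZX, zero_mulVec]
  refine ⟨fun i => ?_, u, hu, fun i j hij =>
    dotProduct_eq_zero_of_one_sub_sum_posSemidef hu hU.2.2 hij, hX⟩
  refine le_antisymm (hX i ▸ rank_vecMulVec_le _ _) (Nat.one_le_iff_ne_zero.2 fun h => ?_)
  have h0 : (X i).mulVecLin = 0 := LinearMap.range_eq_bot.1 (Submodule.finrank_eq_zero.1 h)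
  have h1 := congrArg (u i ⬝ᵥ ·) (LinearMap.congr_fun h0 (u i))
  simp [hX i, vecMulVec_mulVec, hu i] at h1
end

section
/- Let M_1,...,M_k be real symmetric positive semidefinite d×d matrices that are jointly diagonalizable, i.e., there exists an orthogonal matrix Q ∈ ℝ^{d×d} such that Qᵀ M_i Q is diagonal for every i = 1,...,k. If the primal SDP (SDP-P) has a unique primal optimal solution, then there exists a dual optimal solution (Y, Z_1,...,Z_k, ν) of (SDP-D) with rank(Z_i) ≥ d−1 for all i = 1,...,k. -/
open Matrix

section Potential
variable {V : Type*}

/-- The total weight of the arcs of a list of vertices, read as a path that starts at the last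
entry and ends at the head. -/
def pathWeight (c : V → V → ℝ) : List V → ℝ
  | [] => 0
  | [_] => 0
  | a :: b :: l => c b a + pathWeight c (b :: l)

lemma pathWeight_append (c : V → V → ℝ) (s : List V) (j : V) (t : List V) :
    pathWeight c (s ++ j :: t) = pathWeight c (s ++ [j]) + pathWeight c (j :: t) := by
  induction s with
  | nil => simp [pathWeight]
  | cons a s ih =>
    cases s with
    | nil => simp [pathWeight]
    | cons b s => simp only [List.cons_append, pathWeight] at ih ⊢; rw [ih]; ring

lemma sum_formPerm_eq_pathWeight [Fintype V] [DecidableEq V] (c : V → V → ℝ)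
    (hc : ∀ v, c v v = 0) (l : List V) (a : V) (h : (a :: l).Nodup) :
    ∑ v, c ((a :: l).formPerm v) v
      = pathWeight c (a :: l) + c a ((a :: l).getLast (by simp)) := by
  induction l generalizing a with
  | nil => simp [pathWeight, hc]
  | cons b l ih =>
    have hb : (b :: l).Nodup := (List.nodup_cons.1 h).2
    have ha : a ∉ b :: l := (List.nodup_cons.1 h).1
    have hi := ih b hb
    have hlast : (b :: l).formPerm ((b :: l).getLast (by simp)) = b :=
      List.formPerm_apply_getLast b l
    have hmem : (b :: l).getLast (by simp) ∈ b :: l := List.getLast_mem _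
    rw [List.getLast_cons (by simp : b :: l ≠ []), List.formPerm_cons_cons]
    set y := (b :: l).getLast (by simp) with hy
    set π := (b :: l).formPerm with hπ
    have hay : y ≠ a := fun h => ha (h ▸ hmem)
    have hπa : π a = a := List.formPerm_apply_of_notMem ha
    have key : ∀ v, c ((Equiv.swap a b * π) v) v
        = c (π v) v + (if v = a then c b a else 0) + (if v = y then c a y - c b y else 0) := by
      intro v
      rw [Equiv.Perm.mul_apply]
      by_cases hva : v = a
      · subst hva; simp [hπa, hc, hay.symm]
      by_cases hvy : v = y
      · rw [hvy, hlast]; simp [hay]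
      · have h1 : π v ≠ a := fun h => hva (π.injective (h.trans hπa.symm))
        have h2 : π v ≠ b := fun h => hvy (π.injective (h.trans hlast.symm))
        rw [Equiv.swap_apply_of_ne_of_ne h1 h2]; simp [hva, hvy]
    simp only [key, Finset.sum_add_distrib, Finset.sum_ite_eq', Finset.mem_univ, if_true, hi,
      pathWeight]
    ring

/-- If no permutation has positive total weight, then the weights are bounded by the differences
of a potential. -/
lemma exists_potential [Fintype V] (c : V → V → ℝ)
    (hc : ∀ v, c v v = 0) (hperm : ∀ τ : Equiv.Perm V, ∑ v, c v (τ v) ≤ 0) :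
    ∃ u : V → ℝ, ∀ i j, c i j ≤ u j - u i := by
  classical
  have hex : ∀ v, ∃ l : List V, (v :: l).Nodup ∧
      ∀ l' : List V, (v :: l').Nodup → pathWeight c (v :: l') ≤ pathWeight c (v :: l) := by
    intro v
    have hfin : {l : List V | (v :: l).Nodup}.Finite := by
      refine Set.Finite.subset (Set.toFinite (Set.range
        (Subtype.val : {l : List V // l.Nodup} → List V))) ?_
      intro l hl
      exact ⟨⟨l, (List.nodup_cons.1 hl).2⟩, rfl⟩
    obtain ⟨l, hl, hmax⟩ := Set.exists_max_image _ (fun l => pathWeight c (v :: l)) hfin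
      ⟨[], by simp⟩
    exact ⟨l, hl, hmax⟩
  choose p hp hmax using hex
  refine ⟨fun v => pathWeight c (v :: p v), fun i j => ?_⟩
  by_cases hj : j ∈ i :: p i
  · obtain ⟨s, t, hst⟩ := List.append_of_mem hj
    have hnd := hp i
    rw [hst] at hnd
    have h1 := hmax j t (List.nodup_append.1 hnd).2.1
    have h2 : pathWeight c (s ++ [j]) + c i j ≤ 0 := by
      cases s with
      | nil =>
        obtain rfl : i = j := by simpa using (List.cons.inj hst).1
        simp [pathWeight, hc]
      | cons a s =>
        obtain rfl : i = a := (List.cons.inj hst).1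
        have hnd' : (i :: (s ++ [j])).Nodup := by
          have : (i :: (s ++ [j])).Sublist (i :: s ++ j :: t) := by simp
          exact hnd.sublist this
        have h3 := sum_formPerm_eq_pathWeight c hc (s ++ [j]) i hnd'
        have h4 := hperm ((i :: (s ++ [j])).formPerm)⁻¹
        rw [← Equiv.sum_comp ((i :: (s ++ [j])).formPerm)] at h4
        simp only [Equiv.Perm.inv_def, Equiv.symm_apply_apply] at h4
        have h5 : (i :: (s ++ [j])).getLast (by simp) = j := by simp
        rw [h5] at h3
        simp only [List.cons_append]
        linarith
    have h3 := pathWeight_append c s j t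
    rw [← hst] at h3
    simp only
    linarith
  · have := hmax j (i :: p i) (List.nodup_cons.2 ⟨hj, hp i⟩)
    simp only [pathWeight] at this
    linarith

end Potential

/-- Linear programming duality for the assignment problem. -/
lemma exists_assignment_dual {ι V : Type*} [Fintype ι] [Fintype V] [Nonempty V]
    (m : ι → V → ℝ) (σ : ι → V) (hσ : σ.Injective)
    (hopt : ∀ τ : ι → V, τ.Injective → ∑ i, m i (τ i) ≤ ∑ i, m i (σ i)) :
    ∃ (y : V → ℝ) (ν : ι → ℝ), (∀ j, 0 ≤ y j) ∧ (∀ i j, m i j ≤ y j + ν i) ∧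
      ∑ j, y j + ∑ i, ν i = ∑ i, m i (σ i) := by
  classical
  let c : V → V → ℝ := fun j j' => Function.extend σ (fun i => m i j' - m i j) 0 j
  have hc1 : ∀ i j', c (σ i) j' = m i j' - m i (σ i) := fun i j' => by
    simp only [c]; rw [hσ.extend_apply]
  have hc2 : ∀ j, j ∉ Set.range σ → ∀ j', c j j' = 0 := fun j hj j' => by
    simp only [c]; rw [Function.extend_apply' _ _ _ (fun h => hj h)]; rfl
  obtain ⟨u, hu⟩ := exists_potential c
    (fun v => by
      by_cases hv : v ∈ Set.range σ
      · obtain ⟨i, rfl⟩ := hv; simp [hc1]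
      · exact hc2 v hv v)
    (fun τ => by
      rw [← Fintype.sum_of_injective σ hσ (fun i => c (σ i) (τ (σ i))) (fun v => c v (τ v))
        (fun v hv => hc2 v hv _) (fun _ => rfl)]
      simp only [hc1, Finset.sum_sub_distrib]
      exact sub_nonpos.2 (hopt (τ ∘ σ) (τ.injective.comp hσ)))
  obtain ⟨v₀, hv₀⟩ := Finite.exists_min u
  refine ⟨fun j => u j - u v₀, fun i => m i (σ i) - (u (σ i) - u v₀),
    fun j => sub_nonneg.2 (hv₀ j), fun i j => ?_, ?_⟩
  · have := hu (σ i) j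
    rw [hc1] at this
    linarith
  · rw [← Fintype.sum_of_injective σ hσ (fun i => u (σ i) - u v₀) (fun v => u v - u v₀)
        (fun v hv => ?_) (fun _ => rfl), ← Finset.sum_add_distrib]
    · simp
    · have := hu v v₀
      rw [hc2 v hv] at this
      linarith [hv₀ v]

open scoped MatrixOrder Matrix.Norms.L2Operator in
lemma Matrix.PosSemidef.trace_mul_nonneg_s10 {n : Type*} [Fintype n] {A B : Matrix n n ℝ}
    (hA : A.PosSemidef) (hB : B.PosSemidef) : 0 ≤ (A * B).trace := by
  classical
  obtain ⟨C, rfl⟩ := CStarAlgebra.nonneg_iff_eq_star_mul_self.mp hA.nonneg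
  rw [Matrix.mul_assoc, Matrix.trace_mul_comm]
  exact (hB.mul_mul_conjTranspose_same C).trace_nonneg

/-- Weak duality between (SDP-P) and (SDP-D). -/
lemma primalObj_le_dualObj {d k : ℕ} {M X Z : Fin k → Matrix (Fin d) (Fin d) ℝ}
    {Y : Matrix (Fin d) (Fin d) ℝ} {ν : Fin k → ℝ}
    (hX : PrimalFeasible X) (hY : DualFeasible M Y Z ν) : primalObj M X ≤ dualObj Y ν := by
  have h1 : ∀ i, (M i * X i).trace = (Y * X i).trace - (Z i * X i).trace + ν i := by
    intro i
    have : M i = Y - Z i + ν i • (1 : Matrix (Fin d) (Fin d) ℝ) := by rw [hY.2.2 i]; abel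
    rw [this, add_mul, sub_mul, trace_add, trace_sub, smul_mul_assoc, one_mul, trace_smul,
      hX.2.1 i, smul_eq_mul, mul_one]
  have h2 := hY.1.trace_mul_nonneg_s10 hX.2.2
  rw [mul_sub, mul_one, trace_sub, Finset.mul_sum, trace_sum] at h2
  have h3 : 0 ≤ ∑ i, (Z i * X i).trace :=
    Finset.sum_nonneg fun i _ => (hY.2.1 i).trace_mul_nonneg_s10 (hX.1 i)
  simp only [primalObj, dualObj, h1, Finset.sum_add_distrib, Finset.sum_sub_distrib]
  linarith

section Conjugation
variable {n : Type*} [Fintype n] [DecidableEq n] {Q : Matrix n n ℝ}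

lemma posSemidef_mul_diagonal_mul_transpose (Q : Matrix n n ℝ) {w : n → ℝ} (hw : 0 ≤ w) :
    (Q * diagonal w * Qᵀ).PosSemidef := by
  simpa [conjTranspose_eq_transpose_of_trivial] using
    (PosSemidef.diagonal hw).mul_mul_conjTranspose_same Q

lemma trace_mul_diagonal_mul_transpose (hQ : Qᵀ * Q = 1) (w : n → ℝ) :
    (Q * diagonal w * Qᵀ).trace = ∑ j, w j := by
  rw [trace_mul_comm, ← Matrix.mul_assoc, hQ, one_mul, trace_diagonal]

lemma mul_diagonal_mul_transpose_mul (hQ : Qᵀ * Q = 1) (v w : n → ℝ) :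
    Q * diagonal v * Qᵀ * (Q * diagonal w * Qᵀ) = Q * diagonal (fun j => v j * w j) * Qᵀ := by
  calc _ = Q * diagonal v * (Qᵀ * Q) * diagonal w * Qᵀ := by simp only [Matrix.mul_assoc]
    _ = _ := by rw [hQ, Matrix.mul_one, Matrix.mul_assoc Q, diagonal_mul_diagonal]

lemma rank_mul_diagonal_mul_transpose (hQ : Qᵀ * Q = 1) (w : n → ℝ) :
    (Q * diagonal w * Qᵀ).rank = Fintype.card {j // w j ≠ 0} := by
  have h1 : IsUnit Q.det := (isUnit_iff_isUnit_det Q).1 (IsUnit.of_mul_eq_one_right _ hQ)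
  have h2 : IsUnit Qᵀ.det := by rwa [det_transpose]
  rw [rank_mul_eq_left_of_isUnit_det _ _ h2, rank_mul_eq_right_of_isUnit_det _ _ h1, rank_diagonal]

lemma diagonal_injective_conj (hQ : Qᵀ * Q = 1) {v w : n → ℝ}
    (h : Q * diagonal v * Qᵀ = Q * diagonal w * Qᵀ) : v = w := by
  have key : ∀ u : n → ℝ, Qᵀ * (Q * diagonal u * Qᵀ) * Q = diagonal u := fun u => by
    calc _ = Qᵀ * Q * diagonal u * (Qᵀ * Q) := by simp only [Matrix.mul_assoc]
      _ = _ := by rw [hQ, one_mul, mul_one]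
  exact diagonal_injective (by rw [← key v, h, key w])

end Conjugation

/-- The rank one primal point that sends `i` to the projection on the column `τ i` of `Q`. -/
def assignmentPoint {d k : ℕ} (Q : Matrix (Fin d) (Fin d) ℝ) (τ : Fin k → Fin d) (i : Fin k) :
    Matrix (Fin d) (Fin d) ℝ :=
  Q * diagonal (Pi.single (τ i) 1) * Qᵀ

section Assignment
variable {d k : ℕ} {Q : Matrix (Fin d) (Fin d) ℝ}

lemma primalFeasible_assignmentPoint (hQ : Qᵀ * Q = 1) {τ : Fin k → Fin d} (hτ : τ.Injective) :
    PrimalFeasible (assignmentPoint Q τ) := by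
  have hQ' : Q * Qᵀ = 1 := mul_eq_one_comm.1 hQ
  refine ⟨fun i => posSemidef_mul_diagonal_mul_transpose Q (Pi.single_nonneg.2 zero_le_one),
    fun i => ?_, ?_⟩
  · simp [assignmentPoint, trace_mul_diagonal_mul_transpose hQ]
  · have h : (1 : Matrix (Fin d) (Fin d) ℝ) - ∑ i, assignmentPoint Q τ i
        = Q * diagonal (1 - ∑ i, Pi.single (τ i) 1) * Qᵀ := by
      have h1 : diagonal (1 - ∑ i, Pi.single (τ i) 1)
          = (1 : Matrix (Fin d) (Fin d) ℝ) - ∑ i, diagonal (Pi.single (τ i) 1) := by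
        have := map_sum (diagonalAddMonoidHom (Fin d) ℝ) (fun i => Pi.single (τ i) (1 : ℝ))
          Finset.univ
        simp only [diagonalAddMonoidHom_apply] at this
        rw [← this, ← diagonal_one, diagonal_sub]
        rfl
      simp only [assignmentPoint]
      rw [h1, mul_sub, sub_mul, mul_one, hQ', Finset.mul_sum, Finset.sum_mul]
    rw [h]
    refine posSemidef_mul_diagonal_mul_transpose Q fun j => ?_
    simp only [Pi.zero_apply, Pi.sub_apply, Pi.one_apply, Finset.sum_apply, sub_nonneg,
      Pi.single_apply, Finset.sum_boole]
    have : (Finset.univ.filter fun i => j = τ i).card ≤ 1 :=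
      Finset.card_le_one.2 fun a ha b hb => hτ (by simp_all)
    exact_mod_cast this

lemma primalObj_assignmentPoint (hQ : Qᵀ * Q = 1) {M : Fin k → Matrix (Fin d) (Fin d) ℝ}
    {m : Fin k → Fin d → ℝ} (hm : ∀ i, M i = Q * diagonal (m i) * Qᵀ) (τ : Fin k → Fin d) :
    primalObj M (assignmentPoint Q τ) = ∑ i, m i (τ i) := by
  refine Finset.sum_congr rfl fun i _ => ?_
  rw [hm, assignmentPoint, mul_diagonal_mul_transpose_mul hQ, trace_mul_diagonal_mul_transpose hQ]
  simp [Pi.single_apply]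

lemma assignmentPoint_injective (hQ : Qᵀ * Q = 1) :
    Function.Injective (assignmentPoint Q : (Fin k → Fin d) → _) := by
  intro σ τ h
  funext i
  have := congrFun (diagonal_injective_conj hQ (congrFun h i)) (σ i)
  by_contra hne
  simp [hne] at this

/-- Potentials of the assignment problem give a point of (SDP-D). -/
lemma dualFeasible_of_potential (hQ : Qᵀ * Q = 1) {M : Fin k → Matrix (Fin d) (Fin d) ℝ}
    {m : Fin k → Fin d → ℝ} (hm : ∀ i, M i = Q * diagonal (m i) * Qᵀ) {y : Fin d → ℝ}
    {ν : Fin k → ℝ} (hy : ∀ j, 0 ≤ y j) (hyν : ∀ i j, m i j ≤ y j + ν i) :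
    DualFeasible M (Q * diagonal y * Qᵀ)
      (fun i => Q * diagonal (fun j => y j + ν i - m i j) * Qᵀ) ν := by
  have hQ' : Q * Qᵀ = 1 := mul_eq_one_comm.1 hQ
  refine ⟨posSemidef_mul_diagonal_mul_transpose Q hy,
    fun i => posSemidef_mul_diagonal_mul_transpose Q fun j => sub_nonneg.2 (hyν i j),
    fun i => ?_⟩
  have h : ν i • (1 : Matrix (Fin d) (Fin d) ℝ) = Q * diagonal (fun _ => ν i) * Qᵀ := by
    rw [← smul_one_eq_diagonal, mul_smul_comm, mul_one, smul_mul_assoc, hQ']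
  rw [h, hm, ← add_mul, ← mul_add, ← sub_mul, ← mul_sub, diagonal_add, diagonal_sub]
  congr 3
  funext j
  ring

lemma dualObj_of_potential (hQ : Qᵀ * Q = 1) (y : Fin d → ℝ) (ν : Fin k → ℝ) :
    dualObj (Q * diagonal y * Qᵀ) ν = ∑ j, y j + ∑ i, ν i := by
  rw [dualObj, trace_mul_diagonal_mul_transpose hQ]

end Assignment


/-- If the positive semidefinite matrices `M i` are jointly diagonalizable and (SDP-P) has a
unique optimal solution, then (SDP-D) has an optimal solution with `rank (Z i) ≥ d − 1` for
all `i`. -/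
theorem dual_high_rank_of_jointly_diagonalizable {d k : ℕ} (hk : 1 ≤ k) (hkd : k ≤ d)
    (M : Fin k → Matrix (Fin d) (Fin d) ℝ) (hM : ∀ i, (M i).PosSemidef)
    (hdiag : ∃ Q : Matrix (Fin d) (Fin d) ℝ, Qᵀ * Q = 1 ∧ ∀ i, (Qᵀ * M i * Q).IsDiag)
    (huniq : ∃! X : Fin k → Matrix (Fin d) (Fin d) ℝ,
      PrimalFeasible X ∧ ∀ X', PrimalFeasible X' → primalObj M X' ≤ primalObj M X) :
    ∃ (Y : Matrix (Fin d) (Fin d) ℝ) (Z : Fin k → Matrix (Fin d) (Fin d) ℝ) (ν : Fin k → ℝ),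
      DualFeasible M Y Z ν ∧
      (∀ Y' Z' ν', DualFeasible M Y' Z' ν' → dualObj Y ν ≤ dualObj Y' ν') ∧
      (∀ i, d - 1 ≤ (Z i).rank) := by
  obtain ⟨Q, hQ, hD⟩ := hdiag
  have hQ' : Q * Qᵀ = 1 := mul_eq_one_comm.1 hQ
  have : Nonempty (Fin d) := ⟨⟨0, by omega⟩⟩
  obtain ⟨m, hm⟩ : ∃ m : Fin k → Fin d → ℝ, ∀ i, M i = Q * diagonal (m i) * Qᵀ := by
    refine ⟨fun i => (Qᵀ * M i * Q).diag, fun i => ?_⟩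
    rw [(hD i).diagonal_diag]
    calc M i = (Q * Qᵀ) * M i * (Q * Qᵀ) := by rw [hQ', one_mul, mul_one]
      _ = _ := by simp only [Matrix.mul_assoc]
  -- An optimal assignment gives an optimal primal point.
  obtain ⟨σ, hσ, hmax⟩ := Set.exists_max_image {τ : Fin k → Fin d | τ.Injective}
    (fun τ => ∑ i, m i (τ i)) (Set.toFinite _) ⟨Fin.castLE hkd, Fin.castLE_injective hkd⟩
  have hbound : ∀ X, PrimalFeasible X → primalObj M X ≤ ∑ i, m i (σ i) := by
    obtain ⟨y, ν, hy, hyν, hobj⟩ := exists_assignment_dual m σ hσ hmax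
    intro X hX
    rw [← hobj, ← dualObj_of_potential hQ]
    exact primalObj_le_dualObj hX (dualFeasible_of_potential hQ hm hy hyν)
  have hstrict : ∀ τ : Fin k → Fin d, τ.Injective → τ ≠ σ →
      ∑ i, m i (τ i) < ∑ i, m i (σ i) := by
    intro τ hτ hne
    refine lt_of_le_of_ne (hmax τ hτ) fun heq => hne (assignmentPoint_injective hQ ?_)
    refine huniq.unique ⟨primalFeasible_assignmentPoint hQ hτ, fun X hX => ?_⟩
      ⟨primalFeasible_assignmentPoint hQ hσ, fun X hX => ?_⟩
    · rw [primalObj_assignmentPoint hQ hm, heq]; exact hbound X hX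
    · rw [primalObj_assignmentPoint hQ hm]; exact hbound X hX
  -- The optimal assignment stays optimal after a small increase of the other entries.
  obtain ⟨ε, hε, hgap⟩ : ∃ ε : ℝ, 0 < ε ∧ ∀ τ : Fin k → Fin d, τ.Injective → τ ≠ σ →
      ∑ i, m i (τ i) + k * ε ≤ ∑ i, m i (σ i) := by
    have hev : ∀ᶠ ε : ℝ in nhdsWithin 0 (Set.Ioi 0), ∀ τ : Fin k → Fin d,
        τ.Injective → τ ≠ σ → ∑ i, m i (τ i) + k * ε ≤ ∑ i, m i (σ i) := by
      refine Filter.eventually_all.2 fun τ => ?_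
      by_cases hτ : τ.Injective ∧ τ ≠ σ
      · have hcont : Filter.Tendsto (fun ε : ℝ => ∑ i, m i (τ i) + k * ε) (nhds 0)
            (nhds (∑ i, m i (τ i) + k * 0)) := Continuous.tendsto (by fun_prop) 0
        rw [mul_zero, add_zero] at hcont
        filter_upwards [(hcont.mono_left nhdsWithin_le_nhds).eventually_lt_const
          (hstrict τ hτ.1 hτ.2)] with ε h _ _ using h.le
      · exact Filter.Eventually.of_forall fun ε h1 h2 => (hτ ⟨h1, h2⟩).elim
    obtain ⟨ε, h1, h2⟩ := (hev.and self_mem_nhdsWithin).exists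
    exact ⟨ε, h2, h1⟩
  obtain ⟨y, ν, hy, hyν, hobj⟩ := exists_assignment_dual
    (fun i j => m i j + if j = σ i then 0 else ε) σ hσ (fun τ hτ => by
      by_cases hne : τ = σ
      · rw [hne]
      · simp only [if_true, add_zero, Finset.sum_add_distrib]
        refine le_trans (add_le_add_right ?_ _) (hgap τ hτ hne)
        calc ∑ i, (if τ i = σ i then 0 else ε) ≤ ∑ _i : Fin k, ε :=
              Finset.sum_le_sum fun i _ => by split_ifs <;> linarith
          _ = k * ε := by simp)
  simp only [if_true, add_zero] at hobj
  have hyν' : ∀ i j, m i j ≤ y j + ν i := fun i j => by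
    have := hyν i j
    split_ifs at this <;> linarith
  refine ⟨_, _, ν, dualFeasible_of_potential hQ hm hy hyν', fun Y' Z' ν' h' => ?_, fun i => ?_⟩
  · rw [dualObj_of_potential hQ, hobj, ← primalObj_assignmentPoint hQ hm]
    exact primalObj_le_dualObj (primalFeasible_assignmentPoint hQ hσ) h'
  · rw [rank_mul_diagonal_mul_transpose hQ, Fintype.card_subtype]
    calc d - 1 = (Finset.univ.erase (σ i)).card := by simp
      _ ≤ _ := Finset.card_le_card fun j hj => by
        have hne : j ≠ σ i := Finset.ne_of_mem_erase hj
        have := hyν i j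
        rw [if_neg hne] at this
        exact Finset.mem_filter.2 ⟨Finset.mem_univ _, (by linarith : 0 < y j + ν i - m i j).ne'⟩
end
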